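/- Let c > 0 and K > 0, let T ∈ ℝ, and let f : (−∞, T] → ℝ be a differentiable function satisfying f'(t) ≥ c·f(t)² and f(t) ≥ −K for all t ≤ T. Then f(t) ≥ 0 for all t ≤ T. -/

import Mathlib

/-- If `f : (-∞, T] → ℝ` is differentiable with `f' ≥ c * f ^ 2`
and `f ≥ -K` on `(-∞, T]`, where `c > 0` and `K > 0`, then `f ≥ 0` on `(-∞, T]`. -/
theorem stmt4 (c K T : ℝ) (hc : 0 < c) (hK : 0 < K) (f f' : ℝ → ℝ)
    (hderiv : ∀ t ∈ Set.Iic T, HasDerivWithinAt f (f' t) (Set.Iic T) t)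
    (hineq : ∀ t ∈ Set.Iic T, c * f t ^ 2 ≤ f' t)
    (hbound : ∀ t ∈ Set.Iic T, -K ≤ f t) :
    ∀ t ∈ Set.Iic T, 0 ≤ f t := by
  have hmono : MonotoneOn f (Set.Iic T) := by
    refine monotoneOn_of_hasDerivWithinAt_nonneg (f' := f') (convex_Iic T)
      (fun s hs => (hderiv s hs).continuousWithinAt)
      (fun s hs => (hderiv s (interior_subset hs)).mono interior_subset) fun s hs => ?_
    have := hineq s (interior_subset hs)
    nlinarith [mul_nonneg hc.le (sq_nonneg (f s))]
  intro t ht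
  by_contra! hneg
  have hsub : Set.Iic t ⊆ Set.Iic T := Set.Iic_subset_Iic.2 ht
  have hC : 0 < c * f t ^ 2 := mul_pos hc (sq_pos_of_neg hneg)
  have hmono' : MonotoneOn (fun s => f s - c * f t ^ 2 * s) (Set.Iic t) := by
    have hd : ∀ s ∈ Set.Iic t, HasDerivWithinAt (fun s => f s - c * f t ^ 2 * s)
        (f' s - c * f t ^ 2) (Set.Iic t) s := fun s hs => by
      simpa using ((hderiv s (hsub hs)).mono hsub).fun_sub
        ((hasDerivWithinAt_id s (Set.Iic t)).const_mul (c * f t ^ 2))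
    refine monotoneOn_of_hasDerivWithinAt_nonneg (convex_Iic t)
      (fun s hs => (hd s hs).continuousWithinAt)
      (fun s hs => (hd s (interior_subset hs)).mono interior_subset) fun s hs => ?_
    have hs' := interior_subset hs
    have hle : f s ≤ f t := hmono (hsub hs') ht hs'
    have hsq : f t ^ 2 ≤ f s ^ 2 := by nlinarith
    linarith [hineq s (hsub hs'), mul_le_mul_of_nonneg_left hsq hc.le]
  have hs : t - K / (c * f t ^ 2) ∈ Set.Iic t := by
    have : 0 < K / (c * f t ^ 2) := div_pos hK hC
    simpa using this.le
  have hle := hmono' hs Set.self_mem_Iic hs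
  have hmul : c * f t ^ 2 * (K / (c * f t ^ 2)) = K := mul_div_cancel₀ _ hC.ne'
  have hlow := hbound _ (hsub hs)
  simp only [mul_sub, hmul] at hle
  linarith
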